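/- arXiv:1701.04180 — 2 statements merged into one kernel-verified Lean document; each statement's English description precedes it below -/
import Mathlib

section
/- The Hamming weight distribution of the code C_{40,1}^{DE} = ρ_B(E_10) is: A_0 = 1, A_8 = 285 = A_32, A_12 = 21280 = A_28, A_16 = 239970 = A_24, A_20 = 525504, A_40 = 1, and A_w = 0 for all other weights w, where A_w denotes the number of codewords of Hamming weight w. -/
open scoped BigOperators

section Defs

variable {F : Type} [Field F] [DecidableEq F]

/-- The binary coordinate in column `j` (0-indexed), row `k`. -/
def idx (j : Fin 10) (k : Fin 4) : Fin 40 :=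
  ⟨4 * j.val + k.val, by have := j.isLt; have := k.isLt; omega⟩

/-- The map φ : GF(4) → 𝔽₂⁴, 0↦0000, 1↦0011, ω↦0101, ϖ↦0110. -/
def phi (ω : F) : F → (Fin 4 → ZMod 2) := fun x =>
  if x = 0 then ![0, 0, 0, 0]
  else if x = 1 then ![0, 0, 1, 1]
  else if x = ω then ![0, 1, 0, 1]
  else ![0, 1, 1, 0]

/-- Ĉ : the image of a quaternary code under coordinatewise φ. -/
def hatSet (ω : F) (C : Set (Fin 10 → F)) : Set (Fin 40 → ZMod 2) :=
  { v | ∃ c ∈ C, ∀ (j : Fin 10) (k : Fin 4), v (idx j k) = phi ω (c j) k }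

/-- d₄¹⁰ : binary vectors of length 40 constant on each of the ten columns. -/
def d4ten : Set (Fin 40 → ZMod 2) :=
  { v | ∀ (j : Fin 10) (k k' : Fin 4), v (idx j k) = v (idx j k') }

/-- (d₄¹⁰)₀ : the subcode of d₄¹⁰ of codewords of weight divisible by 8. -/
def d4ten0 : Set (Fin 40 → ZMod 2) :=
  { v | v ∈ d4ten ∧ 8 ∣ hammingNorm v }

/-- The generator 1000 1000 ... 1000 of e_C. -/
def eCvec : Fin 40 → ZMod 2 := fun i => if i.val % 4 = 0 then 1 else 0

/-- The generator 1000 (×9) 0111 of e_B. -/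
def eBvec : Fin 40 → ZMod 2 := fun i =>
  if i.val < 36 then (if i.val % 4 = 0 then 1 else 0)
  else (if i.val % 4 = 0 then 0 else 1)

/-- ρ_C(C) = Ĉ + (d₄¹⁰)₀ + e_C. -/
def rhoC (ω : F) (C : Set (Fin 10 → F)) : Set (Fin 40 → ZMod 2) :=
  { v | ∃ a ∈ hatSet ω C, ∃ b ∈ d4ten0,
      ∃ e ∈ ({0, eCvec} : Set (Fin 40 → ZMod 2)), v = a + b + e }

/-- ρ_B(C) = Ĉ + (d₄¹⁰)₀ + e_B. -/
def rhoB (ω : F) (C : Set (Fin 10 → F)) : Set (Fin 40 → ZMod 2) :=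
  { v | ∃ a ∈ hatSet ω C, ∃ b ∈ d4ten0,
      ∃ e ∈ ({0, eBvec} : Set (Fin 40 → ZMod 2)), v = a + b + e }

/-- The trace inner product x⋆y = Σ Tr(xᵢ ȳᵢ), computed in GF(4) (its value lies
in the prime subfield GF(2)). -/
def traceIP (x y : Fin 10 → F) : F :=
  ∑ i, ((x i * (y i) ^ 2) + (x i * (y i) ^ 2) ^ 2)

/-- The dual of an additive code with respect to the trace inner product. -/
def addDual (C : Set (Fin 10 → F)) : Set (Fin 10 → F) :=
  { x | ∀ c ∈ C, traceIP x c = 0 }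

/-- The dual of a binary code of length 40 under the standard inner product. -/
def binDual (S : Set (Fin 40 → ZMod 2)) : Set (Fin 40 → ZMod 2) :=
  { x | ∀ c ∈ S, ∑ i, x i * c i = 0 }

/-- The dual of a quaternary code under the Hermitian inner product ⟨x,y⟩ = Σ xᵢ ȳᵢ. -/
def hermDual (S : Set (Fin 10 → F)) : Set (Fin 10 → F) :=
  { x | ∀ c ∈ S, ∑ i, x i * (c i) ^ 2 = 0 }

/-- The Hermitian self-dual [10,5,4] code E₁₀ over GF(4). -/
def E10 (ω : F) : Submodule F (Fin 10 → F) :=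
  Submodule.span F {![1,1,1,1,0,0,0,0,0,0], ![0,0,1,1,1,1,0,0,0,0],
    ![0,0,0,0,1,1,1,1,0,0], ![0,0,0,0,0,0,1,1,1,1],
    ![1,0,1,0,1,0,1,0,ω,ω^2]}

/-- The Hermitian self-dual [10,5,4] code B₁₀ over GF(4). -/
def B10 (ω : F) : Submodule F (Fin 10 → F) :=
  Submodule.span F {![1,1,1,1,0,0,0,0,0,0], ![0,1,ω,ω^2,1,0,0,0,0,0],
    ![0,0,0,0,0,1,1,1,1,0], ![0,0,0,0,0,0,1,ω,ω^2,1],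
    ![0,1,ω^2,ω,0,0,1,ω^2,ω,0]}

/-- Interpret a bit as an element of GF(4). -/
def b2f (x : ZMod 2) : F := if x = 1 then 1 else 0

/-- The projection 𝔽₂⁴⁰ → GF(4)¹⁰ : column j ↦ v₂ᵢₙ·1 + v·ω + v·ϖ with row labels 0,1,ω,ϖ. -/
def Proj (ω : F) (v : Fin 40 → ZMod 2) : Fin 10 → F := fun j =>
  b2f (v (idx j 1)) * 1 + b2f (v (idx j 2)) * ω + b2f (v (idx j 3)) * ω ^ 2

/-- The parity of column j (1 = odd number of ones). -/
def colPar (v : Fin 40 → ZMod 2) (j : Fin 10) : ZMod 2 := ∑ k, v (idx j k)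

/-- The parity of the top row (1 = odd number of ones). -/
def topPar (v : Fin 40 → ZMod 2) : ZMod 2 := ∑ j, v (idx j 0)

/-- The coordinate permutation of Fin 10 permuting the five blocks {2m, 2m+1}
as units according to π, preserving order within blocks. -/
def blockPerm (π : Equiv.Perm (Fin 5)) : Fin 10 → Fin 10 := fun t =>
  ⟨2 * (π ⟨t.val / 2, by have := t.isLt; omega⟩).val + t.val % 2, by
    have := (π ⟨t.val / 2, by have := t.isLt; omega⟩).isLt; have := t.isLt; omega⟩

/-- The coordinate permutation of Fin 10 interchanging the two coordinates within
each block belonging to S, fixing all other coordinates. -/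
def blockSwap (S : Finset (Fin 5)) : Fin 10 → Fin 10 := fun t =>
  if (⟨t.val / 2, by have := t.isLt; omega⟩ : Fin 5) ∈ S then
    ⟨2 * (t.val / 2) + (1 - t.val % 2), by have := t.isLt; omega⟩
  else t

end Defs

section ColumnDecomposition

/-- The ten columns and four rows index the forty binary coordinates. -/
def columnEquiv : Fin 10 × Fin 4 ≃ Fin 40 := finProdFinEquiv

lemma columnEquiv_apply (j : Fin 10) (k : Fin 4) : columnEquiv (j, k) = idx j k := by
  exact Fin.ext (add_comm _ _)

lemma columnEquiv_symm_idx (j : Fin 10) (k : Fin 4) : columnEquiv.symm (idx j k) = (j, k) := by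
  rw [← columnEquiv_apply, Equiv.symm_apply_apply]

lemma funext_idx {v w : Fin 40 → ZMod 2} (h : ∀ j k, v (idx j k) = w (idx j k)) : v = w := by
  funext i
  obtain ⟨⟨j, k⟩, rfl⟩ := columnEquiv.surjective i
  simpa only [columnEquiv_apply] using h j k

lemma hammingNorm_eq_sum {ι β : Type*} [Fintype ι] [Zero β] [DecidableEq β] (v : ι → β) :
    hammingNorm v = ∑ i, if v i ≠ 0 then 1 else 0 := by
  rw [hammingNorm, Finset.card_filter]

lemma hammingNorm_eq_sum_columns (v : Fin 40 → ZMod 2) :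
    hammingNorm v = ∑ j, hammingNorm fun k => v (idx j k) := by
  simp only [hammingNorm_eq_sum]
  rw [← Equiv.sum_comp columnEquiv, Fintype.sum_prod_type]
  simp only [columnEquiv_apply]

/-- The vector of `d4ten` whose column `j` is constantly `t j`. -/
def columnConst (t : Fin 10 → ZMod 2) : Fin 40 → ZMod 2 := fun i => t (columnEquiv.symm i).1

lemma columnConst_idx (t : Fin 10 → ZMod 2) (j : Fin 10) (k : Fin 4) :
    columnConst t (idx j k) = t j := by
  simp [columnConst, columnEquiv_symm_idx]

lemma hammingNorm_columnConst (t : Fin 10 → ZMod 2) :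
    hammingNorm (columnConst t) = 4 * hammingNorm t := by
  rw [hammingNorm_eq_sum_columns, hammingNorm_eq_sum t, Finset.mul_sum]
  refine Finset.sum_congr rfl fun j _ => ?_
  simp [columnConst_idx, hammingNorm_eq_sum]

lemma natCast_hammingNorm_zmod_two {ι : Type*} [Fintype ι] (t : ι → ZMod 2) :
    (hammingNorm t : ZMod 2) = ∑ i, t i := by
  rw [hammingNorm_eq_sum, Nat.cast_sum]
  refine Finset.sum_congr rfl fun i _ => ?_
  generalize t i = s
  revert s
  decide

lemma columnConst_mem_d4ten0 (t : Fin 10 → ZMod 2) :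
    columnConst t ∈ d4ten0 ↔ ∑ j, t j = 0 := by
  have h : columnConst t ∈ d4ten := fun j k k' => by simp only [columnConst_idx]
  rw [← natCast_hammingNorm_zmod_two, ZMod.natCast_eq_zero_iff]
  simp only [d4ten0, Set.mem_ofPred_eq, h, true_and, hammingNorm_columnConst]
  omega

lemma mem_d4ten0_iff (b : Fin 40 → ZMod 2) :
    b ∈ d4ten0 ↔ ∃ t : Fin 10 → ZMod 2, ∑ j, t j = 0 ∧ b = columnConst t := by
  constructor
  · intro hb
    have hbt : b = columnConst fun j => b (idx j 0) :=
      funext_idx fun j k => by rw [columnConst_idx, hb.1 j k 0]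
    exact ⟨_, (columnConst_mem_d4ten0 _).1 (hbt ▸ hb), hbt⟩
  · rintro ⟨t, ht, rfl⟩
    exact (columnConst_mem_d4ten0 t).2 ht

end ColumnDecomposition

section Words

variable {F : Type} [Field F] [DecidableEq F] {R : Type*} [CommRing R]

/-- Column `j` of a word of `rhoB`, with quaternary symbol `x`, constant part `s` and
coefficient `ε` of `eBvec`. -/
def wordColumn (ω : F) (j : Fin 10) (x : F) (s ε : ZMod 2) : Fin 4 → ZMod 2 :=
  fun k => phi ω x k + s + ε * eBvec (idx j k)

/-- The word of `rhoB` with components `c`, `t` and `ε`. -/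
def word (ω : F) (c : Fin 10 → F) (t : Fin 10 → ZMod 2) (ε : ZMod 2) : Fin 40 → ZMod 2 :=
  fun i => wordColumn ω (columnEquiv.symm i).1 (c (columnEquiv.symm i).1)
    (t (columnEquiv.symm i).1) ε (columnEquiv.symm i).2

lemma word_idx (ω : F) (c : Fin 10 → F) (t : Fin 10 → ZMod 2) (ε : ZMod 2) (j : Fin 10)
    (k : Fin 4) : word ω c t ε (idx j k) = wordColumn ω j (c j) (t j) ε k := by
  simp only [word, columnEquiv_symm_idx]

lemma mem_rhoB_iff (ω : F) (C : Set (Fin 10 → F)) (v : Fin 40 → ZMod 2) :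
    v ∈ rhoB ω C ↔ ∃ c ∈ C, ∃ t : Fin 10 → ZMod 2, ∑ j, t j = 0 ∧ ∃ ε, v = word ω c t ε := by
  constructor
  · rintro ⟨a, ⟨c, hc, ha⟩, b, hb, e, he, rfl⟩
    obtain ⟨t, ht, rfl⟩ := (mem_d4ten0_iff b).1 hb
    have he' : ∃ ε : ZMod 2, e = fun i => ε * eBvec i := by
      rcases he with rfl | rfl
      · exact ⟨0, by funext i; simp⟩
      · exact ⟨1, by funext i; simp⟩
    obtain ⟨ε, rfl⟩ := he'
    exact ⟨c, hc, t, ht, ε, funext_idx fun j k => by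
      simp [word_idx, wordColumn, ha, columnConst_idx]⟩
  · rintro ⟨c, hc, t, ht, ε, rfl⟩
    refine ⟨fun i => phi ω (c (columnEquiv.symm i).1) (columnEquiv.symm i).2,
      ⟨c, hc, fun j k => by simp only [columnEquiv_symm_idx]⟩,
      columnConst t, (columnConst_mem_d4ten0 t).2 ht, fun i => ε * eBvec i, ?_, ?_⟩
    · obtain rfl | rfl : ε = 0 ∨ ε = 1 := by revert ε; decide
      · left; funext i; simp
      · right; funext i; simp
    · exact funext_idx fun j k => by
        simp [word_idx, wordColumn, columnConst_idx, columnEquiv_symm_idx]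

lemma phi_mem (ω x : F) : (x = 0 ∧ phi ω x = ![0, 0, 0, 0]) ∨ (x ≠ 0 ∧
    (phi ω x = ![0, 0, 1, 1] ∨ phi ω x = ![0, 1, 0, 1] ∨ phi ω x = ![0, 1, 1, 0])) := by
  unfold phi
  split_ifs with h0 h1 h2
  · exact .inl ⟨h0, rfl⟩
  · exact .inr ⟨h0, .inl rfl⟩
  · exact .inr ⟨h0, .inr (.inl rfl)⟩
  · exact .inr ⟨h0, .inr (.inr rfl)⟩

lemma sum_phi (ω x : F) : ∑ k, phi ω x k = 0 := by
  rcases phi_mem ω x with ⟨_, h⟩ | ⟨_, h | h | h⟩ <;> rw [h] <;> decide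

lemma phi_zero_row (ω x : F) : phi ω x 0 = 0 := by
  rcases phi_mem ω x with ⟨_, h⟩ | ⟨_, h | h | h⟩ <;> rw [h] <;> rfl

lemma sum_wordColumn (ω : F) (j : Fin 10) (x : F) (s ε : ZMod 2) :
    ∑ k, wordColumn ω j x s ε k = ε := by
  simp only [wordColumn, Finset.sum_add_distrib, sum_phi, ← Finset.mul_sum]
  revert j s ε
  decide

lemma word_injective {ω : F} (hphi : Function.Injective (phi ω)) {c c' : Fin 10 → F}
    {t t' : Fin 10 → ZMod 2} {ε ε' : ZMod 2} (h : word ω c t ε = word ω c' t' ε') :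
    c = c' ∧ t = t' ∧ ε = ε' := by
  have hcol (j : Fin 10) : wordColumn ω j (c j) (t j) ε = wordColumn ω j (c' j) (t' j) ε' := by
    funext k
    rw [← word_idx, ← word_idx, h]
  have hε : ε = ε' := by
    rw [← sum_wordColumn ω 0 (c 0) (t 0) ε, hcol, sum_wordColumn]
  subst hε
  have ht : t = t' := by
    funext j
    simpa [wordColumn, phi_zero_row] using congrFun (hcol j) 0
  subst ht
  refine ⟨funext fun j => hphi (funext fun k => ?_), rfl, rfl⟩
  simpa [wordColumn] using congrFun (hcol j) k

/-- The nontrivial additive character of `ZMod 2`, with values in `R`. -/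
def signChar (R : Type*) [CommRing R] (s : ZMod 2) : R := if s = 0 then 1 else -1

lemma signChar_add (a b : ZMod 2) : signChar R (a + b) = signChar R a * signChar R b := by
  obtain rfl | rfl : a = 0 ∨ a = 1 := by revert a; decide
  all_goals obtain rfl | rfl : b = 0 ∨ b = 1 := by revert b; decide
  all_goals simp [signChar, show (1 + 1 : ZMod 2) = 0 from rfl]

lemma signChar_sum {ι : Type*} (s : Finset ι) (t : ι → ZMod 2) :
    signChar R (∑ i ∈ s, t i) = ∏ i ∈ s, signChar R (t i) := by
  classical
  induction s using Finset.induction_on with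
  | empty => simp [signChar]
  | insert a s ha ih => rw [Finset.sum_insert ha, Finset.prod_insert ha, signChar_add, ih]

lemma two_mul_sum_even_prod {ι : Type*} [Fintype ι] [DecidableEq ι] (g : ι → ZMod 2 → R) :
    2 * ∑ t : ι → ZMod 2 with ∑ j, t j = 0, ∏ j, g j (t j) =
      ∏ j, (g j 0 + g j 1) + ∏ j, (g j 0 - g j 1) := by
  have h1 : ∏ j, (g j 0 + g j 1) = ∑ t : ι → ZMod 2, ∏ j, g j (t j) := by
    rw [← Fintype.prod_sum]
    exact Finset.prod_congr rfl fun j _ => (Fin.sum_univ_two (g j)).symm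
  have h2 : ∏ j, (g j 0 - g j 1) =
      ∑ t : ι → ZMod 2, signChar R (∑ j, t j) * ∏ j, g j (t j) := by
    simp only [signChar_sum, ← Finset.prod_mul_distrib]
    rw [← Fintype.prod_sum fun j s => signChar R s * g j s]
    refine Finset.prod_congr rfl fun j _ => ?_
    refine Eq.trans ?_ (Fin.sum_univ_two fun s : ZMod 2 => signChar R s * g j s).symm
    change _ = signChar R 0 * g j 0 + signChar R 1 * g j 1
    simp [signChar, sub_eq_add_neg]
  rw [h1, h2, ← Finset.sum_add_distrib, Finset.sum_filter, Finset.mul_sum]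
  refine Finset.sum_congr rfl fun t _ => ?_
  by_cases h : ∑ j, t j = 0
  · simp [h, signChar, two_mul]
  · simp [h, signChar]

lemma hammingNorm_wordColumn_zero (ω : F) (j : Fin 10) (x : F) (s : ZMod 2) :
    hammingNorm (wordColumn ω j x s 0) = if x = 0 then (if s = 0 then 0 else 4) else 2 := by
  have h : wordColumn ω j x s 0 = fun k => phi ω x k + s := by
    funext k
    simp [wordColumn]
  rw [h]
  clear h
  rcases phi_mem ω x with ⟨hx, h⟩ | ⟨hx, h | h | h⟩ <;> rw [h] <;>
    simp only [hx, if_true, if_false] <;> revert s <;> decide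

lemma hammingNorm_wordColumn_one (ω : F) (j : Fin 10) (x : F) (s : ZMod 2) :
    hammingNorm (wordColumn ω j x s 1) =
      if (x = 0 ↔ s = 0) ↔ j = 9 then 3 else 1 := by
  have h : wordColumn ω j x s 1 = fun k => phi ω x k + s + eBvec (idx j k) := by
    funext k
    simp [wordColumn]
  rw [h]
  clear h
  rcases phi_mem ω x with ⟨hx, h⟩ | ⟨hx, h | h | h⟩ <;> rw [h] <;>
    simp only [hx] <;> revert s j <;> decide

lemma pow_hammingNorm_word (x : R) (ω : F) (c : Fin 10 → F) (t : Fin 10 → ZMod 2) (ε : ZMod 2) :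
    x ^ hammingNorm (word ω c t ε) =
      ∏ j, x ^ hammingNorm (wordColumn ω j (c j) (t j) ε) := by
  rw [Finset.prod_pow_eq_pow_sum, hammingNorm_eq_sum_columns]
  simp only [word_idx]

lemma prod_ite_eq_zero {ι : Type*} [Fintype ι] (c : ι → F) (a b : R) :
    ∏ j, (if c j = 0 then a else b) =
      a ^ (Fintype.card ι - hammingNorm c) * b ^ hammingNorm c := by
  rw [Finset.prod_ite, Finset.prod_const, Finset.prod_const, hammingNorm]
  congr 2
  have := Finset.card_filter_add_card_filter_not (s := Finset.univ) (fun j => c j = 0)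
  rw [Finset.card_univ] at this
  simp only [ne_eq]
  omega

lemma two_mul_sum_word_zero (x : R) (ω : F) (c : Fin 10 → F) :
    2 * ∑ t : Fin 10 → ZMod 2 with ∑ j, t j = 0, x ^ hammingNorm (word ω c t 0) =
      (1 + x ^ 4) ^ (10 - hammingNorm c) * (2 * x ^ 2) ^ hammingNorm c +
        (1 - x ^ 4) ^ (10 - hammingNorm c) * 0 ^ hammingNorm c := by
  simp only [pow_hammingNorm_word]
  rw [two_mul_sum_even_prod fun j s => x ^ hammingNorm (wordColumn ω j (c j) s 0)]
  have hprod (a b : R) : a ^ (10 - hammingNorm c) * b ^ hammingNorm c =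
      ∏ j, if c j = 0 then a else b := by
    rw [prod_ite_eq_zero, Fintype.card_fin]
  rw [hprod, hprod]
  refine congrArg₂ (· + ·) (Finset.prod_congr rfl fun j _ => ?_)
    (Finset.prod_congr rfl fun j _ => ?_)
  all_goals
    simp only [hammingNorm_wordColumn_zero]
    by_cases h : c j = 0 <;> simp [h, two_mul]

lemma two_mul_sum_word_one (x : R) (ω : F) (c : Fin 10 → F) :
    2 * ∑ t : Fin 10 → ZMod 2 with ∑ j, t j = 0, x ^ hammingNorm (word ω c t 1) =
      (x + x ^ 3) ^ 10 - (-1) ^ hammingNorm c * (x - x ^ 3) ^ 10 := by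
  simp only [pow_hammingNorm_word]
  rw [two_mul_sum_even_prod fun j s => x ^ hammingNorm (wordColumn ω j (c j) s 1), sub_eq_add_neg]
  congr 1
  · have h (j : Fin 10) : x ^ hammingNorm (wordColumn ω j (c j) 0 1) +
        x ^ hammingNorm (wordColumn ω j (c j) 1 1) = x + x ^ 3 := by
      rw [hammingNorm_wordColumn_one, hammingNorm_wordColumn_one]
      generalize c j = x
      by_cases h : x = 0 <;> by_cases hj : j = 9 <;> simp [h, hj, add_comm]
    simp [h]
  · have h (j : Fin 10) : x ^ hammingNorm (wordColumn ω j (c j) 0 1) -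
        x ^ hammingNorm (wordColumn ω j (c j) 1 1) =
          (if c j = 0 then 1 else -1) * ((if j = 9 then -1 else 1) * (x - x ^ 3)) := by
      rw [hammingNorm_wordColumn_one, hammingNorm_wordColumn_one]
      generalize c j = x
      by_cases h : x = 0 <;> by_cases hj : j = 9 <;> simp [h, hj]
    simp only [h, Finset.prod_mul_distrib, prod_ite_eq_zero]
    simp

end Words

section QuaternaryCode

/-- A labelled message of `E10`: four symbols and the coefficient of the last generator, with
`0, 1, 2, 3` standing for the field elements `0, 1, ω, ω + 1`. -/
abbrev Message := Fin 4 × Fin 4 × Fin 4 × Fin 4 × Fin 4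

/-- Multiplication by `ω` on labels. -/
def mulOmega : Fin 4 → Fin 4 := ![0, 2, 3, 1]

/-- Multiplication by `ω + 1` on labels. -/
def mulOmegaBar : Fin 4 → Fin 4 := ![0, 3, 1, 2]

/-- The labels of the codeword of `E10` with a given labelled message. -/
def encode : Message → Fin 10 → Fin 4 := fun (x, y, z, u, b) =>
  ![x ^^^ b, x, y ^^^ b, y, z ^^^ b, z, u ^^^ b, u,
    (x ^^^ y ^^^ z ^^^ u) ^^^ mulOmega b, (x ^^^ y ^^^ z ^^^ u) ^^^ mulOmegaBar b]

lemma encode_injective : Function.Injective encode := by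
  rintro ⟨x, y, z, u, b⟩ ⟨x', y', z', u', b'⟩ h
  have h0 := congrFun h 0
  have h1 : x = x' := congrFun h 1
  have h3 : y = y' := congrFun h 3
  have h5 : z = z' := congrFun h 5
  have h7 : u = u' := congrFun h 7
  subst h1 h3 h5 h7
  have hxor : ∀ x b b' : Fin 4, x ^^^ b = x ^^^ b' → b = b' := by decide
  rw [hxor x b b' h0]

lemma card_hammingNorm_encode : ∀ m ∈ Finset.range 11,
    (Finset.univ.filter fun p : Message => hammingNorm (encode p) = m).card =
      if m = 0 then 1 else if m = 4 then 30 else if m = 6 then 300 else if m = 8 then 585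
      else if m = 10 then 108 else 0 := by
  decide +kernel

lemma sum_hammingNorm_encode {M : Type*} [AddCommMonoid M] (f : ℕ → M) :
    ∑ p : Message, f (hammingNorm (encode p)) =
      f 0 + 30 • f 4 + 300 • f 6 + 585 • f 8 + 108 • f 10 := by
  have hmaps : ∀ p ∈ (Finset.univ : Finset Message), hammingNorm (encode p) ∈ Finset.range 11 :=
    fun p _ => Finset.mem_range.2 (Nat.lt_succ_of_le hammingNorm_le_card_fintype)
  rw [← Finset.sum_fiberwise_of_maps_to hmaps]
  have hfiber : ∀ m ∈ Finset.range 11,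
      ∑ p : Message with hammingNorm (encode p) = m, f (hammingNorm (encode p)) =
        (if m = 0 then 1 else if m = 4 then 30 else if m = 6 then 300 else if m = 8 then 585
          else if m = 10 then 108 else 0) • f m := by
    intro m hm
    rw [← card_hammingNorm_encode m hm, Finset.sum_congr rfl fun p hp => by
      rw [(Finset.mem_filter.1 hp).2], Finset.sum_const]
  rw [Finset.sum_congr rfl hfiber]
  simp [Finset.sum_range_succ]

variable {F : Type} [Field F]

/-- The field element with a given label. -/
def ofLabel (ω : F) : Fin 4 → F := ![0, 1, ω, ω + 1]

lemma two_eq_zero_of_card [Fintype F] (hF : Fintype.card F = 4) : (2 : F) = 0 := by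
  have h := FiniteField.cast_card_eq_zero F
  rw [hF] at h
  have h' : (2 : F) * 2 = 0 := by
    norm_num at h ⊢
    exact h
  simpa using h'

lemma ofLabel_injective {ω : F} (hω : ω ^ 2 = ω + 1) : Function.Injective (ofLabel ω) := by
  have h0 : ω ≠ 0 := by rintro rfl; simp at hω
  have h1 : ω ≠ 1 := by
    rintro rfl
    exact one_ne_zero (by linear_combination -hω : (1 : F) = 0)
  have h3 : ω + 1 ≠ 0 := fun h => h0 (by
    rw [h] at hω; exact pow_eq_zero_iff two_ne_zero |>.1 hω)
  have h4 : ω + 1 ≠ 1 := by simpa using h0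
  intro a b
  fin_cases a <;> fin_cases b <;> simp [ofLabel, h0, h0.symm, h1, h1.symm, h3, h3.symm, h4.symm]

lemma ofLabel_surjective [Fintype F] (hF : Fintype.card F = 4) {ω : F} (hω : ω ^ 2 = ω + 1) :
    Function.Surjective (ofLabel ω) :=
  ((Fintype.bijective_iff_injective_and_card _).2
    ⟨ofLabel_injective hω, by rw [hF, Fintype.card_fin]⟩).2

lemma ofLabel_xor {ω : F} (h2 : (2 : F) = 0) (a b : Fin 4) :
    ofLabel ω (a ^^^ b) = ofLabel ω a + ofLabel ω b := by
  fin_cases a <;> fin_cases b <;> simp [ofLabel] <;> grind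

lemma ofLabel_mulOmega {ω : F} (h2 : (2 : F) = 0) (hω : ω ^ 2 = ω + 1) (a : Fin 4) :
    ofLabel ω (mulOmega a) = ofLabel ω a * ω := by
  fin_cases a <;> simp [ofLabel, mulOmega] <;> grind

lemma ofLabel_mulOmegaBar {ω : F} (h2 : (2 : F) = 0) (hω : ω ^ 2 = ω + 1) (a : Fin 4) :
    ofLabel ω (mulOmegaBar a) = ofLabel ω a * ω ^ 2 := by
  fin_cases a <;> simp [ofLabel, mulOmegaBar] <;> grind

lemma ofLabel_comp_encode {ω : F} (h2 : (2 : F) = 0) (hω : ω ^ 2 = ω + 1) (x y z u b : Fin 4) :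
    ofLabel ω ∘ encode (x, y, z, u, b) =
      ofLabel ω x • ![1,1,1,1,0,0,0,0,0,0] +
        ((ofLabel ω x + ofLabel ω y) • ![0,0,1,1,1,1,0,0,0,0] +
        ((ofLabel ω x + ofLabel ω y + ofLabel ω z) • ![0,0,0,0,1,1,1,1,0,0] +
        ((ofLabel ω x + ofLabel ω y + ofLabel ω z + ofLabel ω u) • ![0,0,0,0,0,0,1,1,1,1] +
        ofLabel ω b • ![1,0,1,0,1,0,1,0,ω,ω^2]))) := by
  funext j
  fin_cases j <;>
    simp [encode, ofLabel_xor h2, ofLabel_mulOmega h2 hω, ofLabel_mulOmegaBar h2 hω] <;>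
    grind

lemma mem_E10_iff [Fintype F] (hF : Fintype.card F = 4) {ω : F} (hω : ω ^ 2 = ω + 1)
    (c : Fin 10 → F) : c ∈ E10 ω ↔ ∃ p, ofLabel ω ∘ encode p = c := by
  have h2 := two_eq_zero_of_card hF
  simp only [E10, Submodule.mem_span_insert, Submodule.mem_span_singleton]
  constructor
  · rintro ⟨a₁, _, ⟨a₂, _, ⟨a₃, _, ⟨a₄, _, ⟨b, rfl⟩, rfl⟩, rfl⟩, rfl⟩, rfl⟩
    obtain ⟨x, hx⟩ := ofLabel_surjective hF hω a₁
    obtain ⟨y, hy⟩ := ofLabel_surjective hF hω (a₁ + a₂)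
    obtain ⟨z, hz⟩ := ofLabel_surjective hF hω (a₂ + a₃)
    obtain ⟨u, hu⟩ := ofLabel_surjective hF hω (a₃ + a₄)
    obtain ⟨b, rfl⟩ := ofLabel_surjective hF hω b
    refine ⟨(x, y, z, u, b), ?_⟩
    rw [ofLabel_comp_encode h2 hω, hx, hy, hz, hu,
      show a₁ + (a₁ + a₂) = a₂ by linear_combination a₁ * h2,
      show a₂ + (a₂ + a₃) = a₃ by linear_combination a₂ * h2,
      show a₃ + (a₃ + a₄) = a₄ by linear_combination a₃ * h2]
  · rintro ⟨⟨x, y, z, u, b⟩, rfl⟩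
    exact ⟨_, _, ⟨_, _, ⟨_, _, ⟨_, _, ⟨_, rfl⟩, rfl⟩, rfl⟩, rfl⟩,
      ofLabel_comp_encode h2 hω x y z u b⟩

lemma phi_injective [Fintype F] [DecidableEq F] (hF : Fintype.card F = 4) {ω : F}
    (hω : ω ^ 2 = ω + 1) :
    Function.Injective (phi ω) := by
  have hinj := ofLabel_injective hω
  have hlabel : ∀ a, phi ω (ofLabel ω a) =
      (![![0, 0, 0, 0], ![0, 0, 1, 1], ![0, 1, 0, 1], ![0, 1, 1, 0]] :
        Fin 4 → Fin 4 → ZMod 2) a := by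
    intro a
    have h0 : ofLabel ω a = 0 ↔ a = 0 := hinj.eq_iff' rfl
    have h1 : ofLabel ω a = 1 ↔ a = 1 := hinj.eq_iff' rfl
    have h2 : ofLabel ω a = ω ↔ a = 2 := hinj.eq_iff' rfl
    simp only [phi, h0, h1, h2]
    clear h0 h1 h2
    revert a
    decide
  intro x y h
  obtain ⟨a, rfl⟩ := ofLabel_surjective hF hω x
  obtain ⟨b, rfl⟩ := ofLabel_surjective hF hω y
  rw [hlabel, hlabel] at h
  congr 1
  revert a b
  decide

end QuaternaryCode

section WeightEnumerator

variable {F : Type} [Field F] [DecidableEq F] {R : Type*} [CommRing R]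

/-- The indexing set of `rhoB ω (E10 ω)`. -/
def parameters : Finset (Message × (Fin 10 → ZMod 2) × ZMod 2) :=
  Finset.univ ×ˢ ({t | ∑ j, t j = 0} : Finset (Fin 10 → ZMod 2)) ×ˢ Finset.univ

lemma two_mul_sum_over_parameters (f : Message → (Fin 10 → ZMod 2) → ZMod 2 → R) :
    2 * ∑ p ∈ parameters, f p.1 p.2.1 p.2.2 =
      ∑ p, (2 * ∑ t : Fin 10 → ZMod 2 with ∑ j, t j = 0, f p t 0 +
        2 * ∑ t : Fin 10 → ZMod 2 with ∑ j, t j = 0, f p t 1) := by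
  rw [parameters, Finset.sum_product, Finset.mul_sum]
  refine Finset.sum_congr rfl fun p _ => ?_
  rw [Finset.sum_product, ← mul_add, ← Finset.sum_add_distrib]
  exact congrArg (2 * ·) (Finset.sum_congr rfl fun t _ => Fin.sum_univ_two (f p t))

/-- Twice the weight enumerator of the words of `rhoB ω C` lying over a codeword of `C` of
even weight `m`. -/
def cosetEnumerator (x : R) (m : ℕ) : R :=
  (1 + x ^ 4) ^ (10 - m) * (2 * x ^ 2) ^ m + (1 - x ^ 4) ^ (10 - m) * 0 ^ m +
    ((x + x ^ 3) ^ 10 - (-1) ^ m * (x - x ^ 3) ^ 10)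

lemma sum_cosetEnumerator (x : R) :
    cosetEnumerator x 0 + 30 • cosetEnumerator x 4 + 300 • cosetEnumerator x 6 +
      585 • cosetEnumerator x 8 + 108 • cosetEnumerator x 10 =
    2 * (1 + 285 * x ^ 8 + 21280 * x ^ 12 + 239970 * x ^ 16 + 525504 * x ^ 20 +
      239970 * x ^ 24 + 21280 * x ^ 28 + 285 * x ^ 32 + x ^ 40) := by
  simp only [cosetEnumerator, nsmul_eq_mul, Nat.cast_ofNat]
  ring

lemma two_mul_sum_parameters (x : R) {ω : F} (hinj : Function.Injective (ofLabel ω)) :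
    2 * ∑ p ∈ parameters, x ^ hammingNorm (word ω (ofLabel ω ∘ encode p.1) p.2.1 p.2.2) =
      2 * (1 + 285 * x ^ 8 + 21280 * x ^ 12 + 239970 * x ^ 16 + 525504 * x ^ 20 +
        239970 * x ^ 24 + 21280 * x ^ 28 + 285 * x ^ 32 + x ^ 40) := by
  rw [two_mul_sum_over_parameters fun p t ε =>
    x ^ hammingNorm (word ω (ofLabel ω ∘ encode p) t ε), ← sum_cosetEnumerator,
    ← sum_hammingNorm_encode]
  refine Finset.sum_congr rfl fun p _ => ?_
  have hnorm : hammingNorm (ofLabel ω ∘ encode p) = hammingNorm (encode p) :=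
    hammingNorm_comp (fun _ => ofLabel ω) (fun _ => hinj) fun _ => rfl
  rw [two_mul_sum_word_zero, two_mul_sum_word_one, hnorm, cosetEnumerator]

open Polynomial in
lemma card_filter_eq_of_two_mul_sum_pow {ι : Type*} (s : Finset ι) (wt : ι → ℕ)
    (h : ∀ {R : Type} [CommRing R] (x : R), 2 * ∑ p ∈ s, x ^ wt p =
      2 * (1 + 285 * x ^ 8 + 21280 * x ^ 12 + 239970 * x ^ 16 + 525504 * x ^ 20 +
        239970 * x ^ 24 + 21280 * x ^ 28 + 285 * x ^ 32 + x ^ 40)) (w : ℕ) :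
    ({p ∈ s | wt p = w} : Finset ι).card =
      if w = 0 then 1
      else if w = 8 then 285
      else if w = 12 then 21280
      else if w = 16 then 239970
      else if w = 20 then 525504
      else if w = 24 then 239970
      else if w = 28 then 21280
      else if w = 32 then 285
      else if w = 40 then 1
      else 0 := by
  have hcoeff := congrArg (fun q => coeff q w) (mul_left_cancel₀ two_ne_zero (h (X : ℤ[X])))
  simp only [finsetSum_coeff, coeff_add, coeff_ofNat_mul, coeff_X_pow, coeff_one,
    eq_comm (a := w) (b := wt _), Finset.sum_boole] at hcoeff
  apply Nat.cast_injective (R := ℤ)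
  rw [hcoeff]
  by_cases hw : w ∈ ({0, 8, 12, 16, 20, 24, 28, 32, 40} : Finset ℕ)
  · fin_cases hw <;> norm_num
  · simp only [Finset.mem_insert, Finset.mem_singleton, not_or] at hw
    simp [hw]

lemma card_rhoB_E10 [Fintype F] (hF : Fintype.card F = 4) {ω : F} (hω : ω ^ 2 = ω + 1)
    (w : ℕ) :
    Nat.card {v : Fin 40 → ZMod 2 //
        v ∈ rhoB ω (E10 ω : Set (Fin 10 → F)) ∧ hammingNorm v = w} =
      ({p ∈ parameters |
        hammingNorm (word ω (ofLabel ω ∘ encode p.1) p.2.1 p.2.2) = w}).card := by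
  have hinj := ofLabel_injective hω
  have hpar : Function.Injective fun p : Message × (Fin 10 → ZMod 2) × ZMod 2 =>
      word ω (ofLabel ω ∘ encode p.1) p.2.1 p.2.2 := by
    rintro ⟨p, t, ε⟩ ⟨p', t', ε'⟩ h
    obtain ⟨hc, ht, hε⟩ := word_injective (phi_injective hF hω) h
    exact Prod.ext (encode_injective (hinj.comp_left hc)) (Prod.ext ht hε)
  have himage :
      {v : Fin 40 → ZMod 2 | v ∈ rhoB ω (E10 ω : Set (Fin 10 → F)) ∧ hammingNorm v = w} =
      (({p ∈ parameters |
          hammingNorm (word ω (ofLabel ω ∘ encode p.1) p.2.1 p.2.2) = w}.image fun p =>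
        word ω (ofLabel ω ∘ encode p.1) p.2.1 p.2.2 :
        Finset (Fin 40 → ZMod 2)) : Set (Fin 40 → ZMod 2)) := by
    ext v
    simp only [Set.mem_ofPred_eq, mem_rhoB_iff, SetLike.mem_coe, mem_E10_iff hF hω,
      Finset.coe_image, Set.mem_image, Finset.mem_filter, parameters, Finset.mem_product,
      Finset.mem_univ, true_and, and_true]
    constructor
    · rintro ⟨⟨_, ⟨p, rfl⟩, t, ht, ε, rfl⟩, hw⟩
      exact ⟨(p, t, ε), ⟨ht, hw⟩, rfl⟩
    · rintro ⟨⟨p, t, ε⟩, ⟨ht, hw⟩, rfl⟩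
      exact ⟨⟨_, ⟨p, rfl⟩, t, ht, ε, rfl⟩, hw⟩
  rw [← Finset.card_image_of_injective _ hpar, ← Set.ncard_coe_finset, ← himage]
  rfl

end WeightEnumerator

/-- The weight distribution of C₄₀,₁ᴰᴱ = ρ_B(E₁₀). -/
theorem stmt_14 (F : Type) [Field F] [Fintype F] [DecidableEq F]
    (hF : Fintype.card F = 4) (ω : F) (hω : ω ^ 2 = ω + 1) :
    ∀ w : ℕ,
      Nat.card {v : Fin 40 → ZMod 2 //
          v ∈ rhoB ω (E10 ω : Set (Fin 10 → F)) ∧ hammingNorm v = w} =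
        if w = 0 then 1
        else if w = 8 then 285
        else if w = 12 then 21280
        else if w = 16 then 239970
        else if w = 20 then 525504
        else if w = 24 then 239970
        else if w = 28 then 21280
        else if w = 32 then 285
        else if w = 40 then 1
        else 0 := by
  intro w
  rw [card_rhoB_E10 hF hω]
  exact card_filter_eq_of_two_mul_sum_pow parameters
    (fun p => hammingNorm (word ω (ofLabel ω ∘ encode p.1) p.2.1 p.2.2))
    (fun x => two_mul_sum_parameters x (ofLabel_injective hω)) w
end

section
/- The covering radius of the code C_{40,1}^{DE} = ρ_B(E_10) is 8: every vector in 𝔽₂^40 is at Hamming distance at most 8 from some codeword of C_{40,1}^{DE}, and some vector in 𝔽₂^40 is at Hamming distance exactly 8 from every nearest codeword. -/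
open scoped BigOperators

/-- The sign character of `ZMod 2`, with integer values. -/
def bitSign (a : ZMod 2) : ℤ := if a = 0 then 1 else -1

theorem bitSign_add (a b : ZMod 2) : bitSign (a + b) = bitSign a * bitSign b := by
  revert a b; decide

theorem sum_bitSign {ι : Type*} [Fintype ι] [DecidableEq ι] (c : ι → ZMod 2) :
    ∑ i, bitSign (c i) = Fintype.card ι - 2 * (hammingNorm c : ℤ) := by
  have h : ∀ i, bitSign (c i) = 1 - 2 * (if c i ≠ 0 then 1 else 0) := by
    intro i
    by_cases hi : c i = 0 <;> simp [bitSign, hi]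
  simp only [h, Finset.sum_sub_distrib, ← Finset.mul_sum, hammingNorm, Finset.sum_boole]
  simp

theorem sum_bitSign_dotProduct_eq_zero {ι : Type*} [Fintype ι] [DecidableEq ι]
    (C : Submodule (ZMod 2) (ι → ZMod 2)) [DecidablePred (· ∈ C)] {y h : ι → ZMod 2}
    (hh : h ∈ C) (hy : y ⬝ᵥ h ≠ 0) :
    ∑ c with c ∈ C, bitSign (y ⬝ᵥ c) = 0 := by
  have key : ∑ c with c ∈ C, bitSign (y ⬝ᵥ c) = ∑ c with c ∈ C, -bitSign (y ⬝ᵥ c) := by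
    refine Finset.sum_bij' (fun c _ => c + h) (fun c _ => c - h) ?_ ?_ ?_ ?_ ?_
    · intro c hc
      simpa using C.add_mem (by simpa using hc) hh
    · intro c hc
      simpa using C.sub_mem (by simpa using hc) hh
    · simp
    · simp
    · intro c _
      rw [dotProduct_add, bitSign_add, bitSign, bitSign, if_neg hy]
      ring
  rw [Finset.sum_neg_distrib] at key
  linarith

theorem sum_bitSign_mul_prod_eq_zero {ι : Type*} [Fintype ι] [DecidableEq ι]
    (C : Submodule (ZMod 2) (ι → ZMod 2)) [DecidablePred (· ∈ C)] (L : List ℤ) (v : ι → ZMod 2)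
    (hv : ∀ y, (∀ c ∈ C, y ⬝ᵥ c = 0) → L.length < hammingDist v y) :
    ∑ c with c ∈ C, bitSign (v ⬝ᵥ c) * (L.map fun a => ∑ i, bitSign (c i) - a).prod = 0 := by
  induction L generalizing v with
  | nil =>
    obtain ⟨h, hh, hy⟩ : ∃ h ∈ C, v ⬝ᵥ h ≠ 0 := by
      by_contra! H
      simpa using hv v H
    simpa using sum_bitSign_dotProduct_eq_zero C hh hy
  | cons a L ih =>
    have hstep : ∀ i, ∑ c with c ∈ C, bitSign ((v + Pi.single i 1) ⬝ᵥ c) *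
        (L.map fun a => ∑ i, bitSign (c i) - a).prod = 0 := by
      intro i
      refine ih _ fun y hy => ?_
      have h1 := hv y hy
      have h2 := hammingDist_triangle v (v + Pi.single i 1) y
      have h3 : hammingDist v (v + Pi.single i 1) ≤ 1 := by
        rw [hammingDist, Finset.card_le_one]
        intro a ha b hb
        have aux : ∀ x, v x ≠ (v + Pi.single i (1 : ZMod 2) : ι → ZMod 2) x → x = i := by
          intro x hx
          by_contra hne
          exact hx (by simp [Pi.single_eq_of_ne hne])
        rw [aux a (by simpa using ha), aux b (by simpa using hb)]
      simp only [List.length_cons] at h1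
      omega
    have hbase := ih v fun y hy => (Nat.lt_succ_self _).trans (hv y hy)
    have hexp : ∀ c : ι → ZMod 2,
        bitSign (v ⬝ᵥ c) * ((a :: L).map fun a => ∑ i, bitSign (c i) - a).prod =
          ∑ i, bitSign ((v + Pi.single i 1) ⬝ᵥ c) *
            (L.map fun a => ∑ i, bitSign (c i) - a).prod -
          a * (bitSign (v ⬝ᵥ c) * (L.map fun a => ∑ i, bitSign (c i) - a).prod) := by
      intro c
      simp only [add_dotProduct, single_dotProduct, one_mul, bitSign_add, List.map_cons,
        List.prod_cons, ← Finset.sum_mul, ← Finset.mul_sum]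
      ring
    simp only [hexp, Finset.sum_sub_distrib, ← Finset.mul_sum]
    rw [Finset.sum_comm]
    simp only [hstep, hbase]
    simp

/-- The Delsarte bound: if the nonzero words of a binary linear code have at most `s` different
weights, then its dual has covering radius at most `s`. -/
theorem exists_dual_hammingDist_le {ι : Type*} [Fintype ι] [DecidableEq ι]
    (C : Submodule (ZMod 2) (ι → ZMod 2)) (W : List ℕ) (hW : 0 ∉ W)
    (hC : ∀ c ∈ C, c ≠ 0 → hammingNorm c ∈ W) (v : ι → ZMod 2) :
    ∃ y, (∀ c ∈ C, y ⬝ᵥ c = 0) ∧ hammingDist v y ≤ W.length := by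
  classical
  by_contra! H
  have hsum := sum_bitSign_mul_prod_eq_zero C
    (W.map fun w : ℕ => (Fintype.card ι - 2 * (w : ℤ))) v (by simpa using H)
  rw [Finset.sum_eq_single 0] at hsum
  · simp only [dotProduct_zero, sum_bitSign, mul_eq_zero, List.prod_eq_zero_iff] at hsum
    rcases hsum with h | h
    · simp [bitSign] at h
    · simp only [List.map_map, List.mem_map, Function.comp_apply, hammingNorm_zero] at h
      obtain ⟨w, hw, h⟩ := h
      have : w = 0 := by push_cast at h; omega
      exact hW (by rwa [this] at hw)
  · intro c hc hne
    rw [mul_eq_zero]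
    right
    rw [List.prod_eq_zero_iff]
    simp only [List.map_map, List.mem_map, Function.comp_apply, sum_bitSign]
    exact ⟨_, hC c (by simpa using hc) hne, by ring⟩
  · simp

/-- Column `j` of a binary vector of length 40. -/
def col (v : Fin 40 → ZMod 2) (j : Fin 10) : Fin 4 → ZMod 2 := fun k => v (idx j k)

/-- The coefficient of `1` in the projection of a column to GF(4). -/
def oneCoef (v : Fin 40 → ZMod 2) (j : Fin 10) : ZMod 2 := v (idx j 1) + v (idx j 3)

/-- The coefficient of `ω` in the projection of a column to GF(4). -/
def omegaCoef (v : Fin 40 → ZMod 2) (j : Fin 10) : ZMod 2 := v (idx j 2) + v (idx j 3)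

/-- The first column of the block `m`. -/
def fstCol (m : Fin 5) : Fin 10 := ⟨2 * m.val, by omega⟩

/-- The second column of the block `m`. -/
def sndCol (m : Fin 5) : Fin 10 := ⟨2 * m.val + 1, by omega⟩

theorem sum_eq_sum_blocks {M : Type*} [AddCommMonoid M] (f : Fin 10 → M) :
    ∑ j, f j = ∑ m, (f (fstCol m) + f (sndCol m)) := by
  simp only [Fin.sum_univ_succ, Fin.sum_univ_zero, fstCol, sndCol, add_assoc]
  rfl

theorem sum_eq_sum_idx {M : Type*} [AddCommMonoid M] (f : Fin 40 → M) :
    ∑ i, f i = ∑ j, ∑ k, f (idx j k) := by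
  rw [← Fintype.sum_prod_type']
  refine (Fintype.sum_bijective (fun p : Fin 10 × Fin 4 => idx p.1 p.2) ?_ _ _ fun _ => rfl).symm
  decide +kernel

theorem forall_fin_ten {p : Fin 10 → Prop} (h : ∀ m, p (fstCol m) ∧ p (sndCol m)) (j : Fin 10) :
    p j := by
  have hj : ∀ j : Fin 10, ∃ m, j = fstCol m ∨ j = sndCol m := by decide
  obtain ⟨m, rfl | rfl⟩ := hj j
  exacts [(h m).1, (h m).2]

theorem hammingNorm_eq_sum_col (v : Fin 40 → ZMod 2) :
    hammingNorm v = ∑ j, hammingNorm (col v j) := by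
  simp only [hammingNorm, Finset.card_filter]
  exact sum_eq_sum_idx fun i => if v i ≠ 0 then 1 else 0

theorem colPar_add (u v : Fin 40 → ZMod 2) (j : Fin 10) :
    colPar (u + v) j = colPar u j + colPar v j := by
  simp [colPar, Finset.sum_add_distrib]

theorem colPar_sub (u v : Fin 40 → ZMod 2) (j : Fin 10) :
    colPar (u - v) j = colPar u j - colPar v j := by
  simp [colPar, Finset.sum_sub_distrib]

theorem topPar_add (u v : Fin 40 → ZMod 2) : topPar (u + v) = topPar u + topPar v := by
  simp [topPar, Finset.sum_add_distrib]

theorem topPar_sub (u v : Fin 40 → ZMod 2) : topPar (u - v) = topPar u - topPar v := by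
  simp [topPar, Finset.sum_sub_distrib]

theorem oneCoef_add (u v : Fin 40 → ZMod 2) (j : Fin 10) :
    oneCoef (u + v) j = oneCoef u j + oneCoef v j := by
  simp only [oneCoef, Pi.add_apply]
  ring

theorem oneCoef_sub (u v : Fin 40 → ZMod 2) (j : Fin 10) :
    oneCoef (u - v) j = oneCoef u j - oneCoef v j := by
  simp only [oneCoef, Pi.sub_apply]
  ring

theorem omegaCoef_add (u v : Fin 40 → ZMod 2) (j : Fin 10) :
    omegaCoef (u + v) j = omegaCoef u j + omegaCoef v j := by
  simp only [omegaCoef, Pi.add_apply]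
  ring

theorem omegaCoef_sub (u v : Fin 40 → ZMod 2) (j : Fin 10) :
    omegaCoef (u - v) j = omegaCoef u j - omegaCoef v j := by
  simp only [omegaCoef, Pi.sub_apply]
  ring

/-- The parity-check description of `ρ_B(E₁₀)`. -/
def checkCode : Submodule (ZMod 2) (Fin 40 → ZMod 2) where
  carrier := { v | (∀ j, colPar v j = colPar v 0) ∧
    (∀ m, oneCoef v (fstCol m) + oneCoef v (sndCol m) = oneCoef v 0 + oneCoef v 1) ∧
    (∀ m, omegaCoef v (fstCol m) + omegaCoef v (sndCol m) = omegaCoef v 0 + omegaCoef v 1) ∧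
    ∑ m, oneCoef v (fstCol m) = omegaCoef v 0 + omegaCoef v 1 ∧
    ∑ m, omegaCoef v (fstCol m) =
      oneCoef v 0 + oneCoef v 1 + (omegaCoef v 0 + omegaCoef v 1) ∧
    topPar v = colPar v 0 }
  zero_mem' := by simp [colPar, oneCoef, omegaCoef, topPar]
  add_mem' := by
    rintro u v ⟨h1, h2, h3, h4, h5, h6⟩ ⟨k1, k2, k3, k4, k5, k6⟩
    simp only [Set.mem_ofPred_eq, colPar_add, oneCoef_add, omegaCoef_add, topPar_add,
      Finset.sum_add_distrib]
    refine ⟨fun j => ?_, fun m => ?_, fun m => ?_, ?_, ?_, ?_⟩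
    · rw [h1, k1]
    · linear_combination h2 m + k2 m
    · linear_combination h3 m + k3 m
    · linear_combination h4 + k4
    · linear_combination h5 + k5
    · linear_combination h6 + k6
  smul_mem' := by
    rintro a v ⟨h1, h2, h3, h4, h5, h6⟩
    have e1 : ∀ j, colPar (a • v) j = a * colPar v j := by
      simp [colPar, Finset.mul_sum]
    have e2 : ∀ j, oneCoef (a • v) j = a * oneCoef v j := by
      intro j; simp only [oneCoef, Pi.smul_apply, smul_eq_mul]; ring
    have e3 : ∀ j, omegaCoef (a • v) j = a * omegaCoef v j := by
      intro j; simp only [omegaCoef, Pi.smul_apply, smul_eq_mul]; ring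
    have e4 : topPar (a • v) = a * topPar v := by
      simp [topPar, Finset.mul_sum]
    simp only [Set.mem_ofPred_eq, e1, e2, e3, e4, ← Finset.mul_sum]
    refine ⟨fun j => ?_, fun m => ?_, fun m => ?_, ?_, ?_, ?_⟩
    · rw [h1]
    · linear_combination a * h2 m
    · linear_combination a * h3 m
    · linear_combination a * h4
    · linear_combination a * h5
    · linear_combination a * h6

theorem mem_checkCode {v : Fin 40 → ZMod 2} : v ∈ checkCode ↔
    (∀ j, colPar v j = colPar v 0) ∧
    (∀ m, oneCoef v (fstCol m) + oneCoef v (sndCol m) = oneCoef v 0 + oneCoef v 1) ∧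
    (∀ m, omegaCoef v (fstCol m) + omegaCoef v (sndCol m) = omegaCoef v 0 + omegaCoef v 1) ∧
    ∑ m, oneCoef v (fstCol m) = omegaCoef v 0 + omegaCoef v 1 ∧
    ∑ m, omegaCoef v (fstCol m) =
      oneCoef v 0 + oneCoef v 1 + (omegaCoef v 0 + omegaCoef v 1) ∧
    topPar v = colPar v 0 := Iff.rfl

instance : DecidablePred (· ∈ checkCode) := fun _ => decidable_of_iff _ mem_checkCode.symm

/-- The vector of length 40 with entry `H j k` in column `j`, row `k`. -/
def ofCols (H : Fin 10 → Fin 4 → ZMod 2) : Fin 40 → ZMod 2 :=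
  fun i => H ⟨i.val / 4, by omega⟩ ⟨i.val % 4, by omega⟩

theorem ofCols_idx (H : Fin 10 → Fin 4 → ZMod 2) (j : Fin 10) (k : Fin 4) :
    ofCols H (idx j k) = H j k := by
  unfold ofCols idx
  congr 1
  · congr 1; simp only; omega
  · ext; simp only; omega

theorem dotProduct_ofCols (y : Fin 40 → ZMod 2) (H : Fin 10 → Fin 4 → ZMod 2) :
    y ⬝ᵥ ofCols H = ∑ j, ∑ k, y (idx j k) * H j k := by
  simp only [dotProduct, sum_eq_sum_idx, ofCols_idx]

/-- The code `checkCode` contains its dual. -/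
theorem mem_checkCode_of_forall_dotProduct (y : Fin 40 → ZMod 2)
    (hy : ∀ c ∈ checkCode, y ⬝ᵥ c = 0) : y ∈ checkCode := by
  have two : ∀ a b : ZMod 2, a + b = 0 → a = b := by decide
  have key : ∀ H, ofCols H ∈ checkCode → ∑ j, ∑ k, y (idx j k) * H j k = 0 := fun H hH => by
    rw [← dotProduct_ofCols, hy _ hH]
  refine mem_checkCode.2 ⟨fun j => ?_, fun m => ?_, fun m => ?_, ?_, ?_, ?_⟩
  · have h := key (fun i _ => (if i = j then 1 else 0) + if i = 0 then 1 else 0)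
      (by revert j; decide +kernel)
    apply two
    simpa [colPar, mul_add, Finset.sum_add_distrib, ← Finset.sum_mul] using h
  · have h := key (fun i k => ((if i = fstCol m then 1 else 0) + (if i = sndCol m then 1 else 0) +
        ((if i = 0 then 1 else 0) + if i = 1 then 1 else 0)) * ![0, 1, 0, 1] k)
      (by revert m; decide +kernel)
    apply two
    simpa [oneCoef, mul_add, add_mul, Finset.sum_add_distrib, Fin.sum_univ_four] using h
  · have h := key (fun i k => ((if i = fstCol m then 1 else 0) + (if i = sndCol m then 1 else 0) +
        ((if i = 0 then 1 else 0) + if i = 1 then 1 else 0)) * ![0, 0, 1, 1] k)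
      (by revert m; decide +kernel)
    apply two
    simpa [omegaCoef, mul_add, add_mul, Finset.sum_add_distrib, Fin.sum_univ_four] using h
  · have h := key (fun i k => (if i.val % 2 = 0 then ![0, 1, 0, 1] k else 0) +
        if i.val < 2 then ![0, 0, 1, 1] k else 0) (by decide +kernel)
    apply two
    simpa [oneCoef, omegaCoef, mul_add, Finset.sum_add_distrib, Fin.sum_univ_four,
      sum_eq_sum_blocks, fstCol, sndCol, Fin.sum_univ_five] using h
  · have h := key (fun i k => (if i.val % 2 = 0 then ![0, 0, 1, 1] k else 0) +
        if i.val < 2 then ![0, 1, 0, 1] k + ![0, 0, 1, 1] k else 0) (by decide +kernel)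
    apply two
    simp [oneCoef, omegaCoef, mul_add, Finset.sum_add_distrib, Fin.sum_univ_four,
      sum_eq_sum_blocks, fstCol, sndCol, Fin.sum_univ_five] at h ⊢
    linear_combination h
  · have h := key (fun i k => (if k = 0 then 1 else 0) + if i = 0 then 1 else 0)
      (by decide +kernel)
    apply two
    simpa [topPar, colPar, mul_add, Finset.sum_add_distrib, Fin.sum_univ_four] using h

/-- The additive map `𝔽₂ → ℤ/4` with `1 ↦ 2`. -/
def bitToFour : ZMod 2 →+ ZMod 4 := AddMonoidHom.mk' (fun a => if a = 0 then 0 else 2) (by decide)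

/-- The additive map `𝔽₂ → ℤ/8` with `1 ↦ 4`. -/
def bitToEight : ZMod 2 →+ ZMod 8 := AddMonoidHom.mk' (fun a => if a = 0 then 0 else 4) (by decide)

theorem block_weight_mod_four : ∀ (a b : Fin 4 → ZMod 2), ∑ k, a k = ∑ k, b k →
    ((hammingNorm a + hammingNorm b : ℕ) : ZMod 4) = bitToFour
      ((∑ k, a k) * (1 + (a 0 + b 0)) +
        ((a 1 + a 3 + (b 1 + b 3)) + (a 2 + a 3 + (b 2 + b 3)) +
          (a 1 + a 3 + (b 1 + b 3)) * (a 2 + a 3 + (b 2 + b 3))) +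
        ((a 1 + a 3) * (a 2 + a 3 + (b 2 + b 3)) +
          (a 2 + a 3) * (a 1 + a 3 + (b 1 + b 3)))) := by
  decide +kernel

theorem block_weight_bounds : ∀ (a b : Fin 4 → ZMod 2), ∑ k, a k = ∑ k, b k →
    (∑ k, a k ≠ 0 ∨ a 1 + a 3 + (b 1 + b 3) ≠ 0 ∨ a 2 + a 3 + (b 2 + b 3) ≠ 0) →
    2 ≤ hammingNorm a + hammingNorm b ∧ hammingNorm a + hammingNorm b ≤ 6 := by
  decide +kernel

theorem block_weight_eq_four : ∀ (a b : Fin 4 → ZMod 2), 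
    (∑ k, a k = 0 ∧ ∑ k, b k = 0 ∧
      a 1 + a 3 + (b 1 + b 3) = 0 ∧ a 2 + a 3 + (b 2 + b 3) = 0 ∧
      (a 1 + a 3 ≠ 0 ∨ a 2 + a 3 ≠ 0)) → hammingNorm a + hammingNorm b = 4 := by
  decide +kernel

theorem weight_mod_eight : ∀ (a : Fin 4 → ZMod 2), ∑ k, a k = 0 →
    a 1 + a 3 = 0 → a 2 + a 3 = 0 → ((hammingNorm a : ℕ) : ZMod 8) = bitToEight (a 0) := by
  decide +kernel

theorem four_dvd_hammingNorm {v : Fin 40 → ZMod 2} (hv : v ∈ checkCode) : 4 ∣ hammingNorm v := by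
  obtain ⟨h1, h2, h3, h4, h5, h6⟩ := mem_checkCode.1 hv
  have hb : ∀ m, ((hammingNorm (col v (fstCol m)) + hammingNorm (col v (sndCol m)) : ℕ) : ZMod 4) =
      bitToFour (colPar v 0 * (1 + (v (idx (fstCol m) 0) + v (idx (sndCol m) 0))) +
        ((oneCoef v 0 + oneCoef v 1) + (omegaCoef v 0 + omegaCoef v 1) +
          (oneCoef v 0 + oneCoef v 1) * (omegaCoef v 0 + omegaCoef v 1)) +
        (oneCoef v (fstCol m) * (omegaCoef v 0 + omegaCoef v 1) +
          omegaCoef v (fstCol m) * (oneCoef v 0 + oneCoef v 1))) := by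
    intro m
    rw [← h2 m, ← h3 m, ← h1 (fstCol m)]
    exact block_weight_mod_four _ _ ((h1 (fstCol m)).trans (h1 (sndCol m)).symm)
  generalize colPar v 0 = p at h6 hb
  generalize oneCoef v 0 + oneCoef v 1 = x at h5 hb
  generalize omegaCoef v 0 + omegaCoef v 1 = y at h4 h5 hb
  rw [← ZMod.natCast_eq_zero_iff, hammingNorm_eq_sum_col, sum_eq_sum_blocks, Nat.cast_sum]
  simp only [hb]
  rw [← map_sum]
  rw [topPar, sum_eq_sum_blocks] at h6
  simp only [Finset.sum_add_distrib, ← Finset.mul_sum, ← Finset.sum_mul, h4, h5] at h6 ⊢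
  rw [h6]
  clear * -
  revert p x y
  decide +kernel

theorem hammingNorm_mem_of_mem_checkCode {v : Fin 40 → ZMod 2} (hv : v ∈ checkCode)
    (hne : v ≠ 0) : hammingNorm v ∈ [8, 12, 16, 20, 24, 28, 32, 40] := by
  have h4 := four_dvd_hammingNorm hv
  obtain ⟨h1, h2, h3, hx, hy, ht⟩ := mem_checkCode.1 hv
  suffices (8 ≤ hammingNorm v ∧ hammingNorm v ≤ 32) ∨ 8 ∣ hammingNorm v by
    have hpos : 0 < hammingNorm v := hammingNorm_pos_iff.2 hne
    have hle : hammingNorm v ≤ 40 := by simpa using hammingNorm_le_card_fintype (x := v)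
    simp only [List.mem_cons, List.not_mem_nil, or_false]
    omega
  by_cases hl : colPar v 0 ≠ 0 ∨ oneCoef v 0 + oneCoef v 1 ≠ 0 ∨ omegaCoef v 0 + omegaCoef v 1 ≠ 0
  · left
    have hb : ∀ m, 2 ≤ hammingNorm (col v (fstCol m)) + hammingNorm (col v (sndCol m)) ∧
        hammingNorm (col v (fstCol m)) + hammingNorm (col v (sndCol m)) ≤ 6 := by
      intro m
      rw [← h2 m, ← h3 m, ← h1 (fstCol m)] at hl
      exact block_weight_bounds _ _ ((h1 (fstCol m)).trans (h1 (sndCol m)).symm) hl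
    rw [hammingNorm_eq_sum_col, sum_eq_sum_blocks, Fin.sum_univ_five]
    have := hb 0; have := hb 1; have := hb 2; have := hb 3; have := hb 4
    omega
  · push Not at hl
    obtain ⟨hp, hl0, hl1⟩ := hl
    simp only [hp, hl0, hl1] at h1 h2 h3 hx hy ht
    by_cases hz : ∀ m, oneCoef v (fstCol m) = 0 ∧ omegaCoef v (fstCol m) = 0
    · right
      have hc : ∀ j, oneCoef v j = 0 ∧ omegaCoef v j = 0 := by
        refine forall_fin_ten fun m => ⟨hz m, ?_⟩
        have := h2 m
        have := h3 m
        simp_all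
      rw [← ZMod.natCast_eq_zero_iff, hammingNorm_eq_sum_col, Nat.cast_sum]
      rw [Finset.sum_congr rfl fun j _ => weight_mod_eight (col v j) (h1 j) (hc j).1 (hc j).2,
        ← map_sum]
      exact (congrArg _ ht).trans (map_zero _)
    · left
      have hfour : ∀ m, (oneCoef v (fstCol m) ≠ 0 ∨ omegaCoef v (fstCol m) ≠ 0) →
          hammingNorm (col v (fstCol m)) + hammingNorm (col v (sndCol m)) = 4 := fun m hm =>
        block_weight_eq_four _ _ ⟨h1 _, h1 _, h2 m, h3 m, hm⟩
      have hle : ∀ j, hammingNorm (col v j) ≤ 4 := fun j => by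
        simpa using hammingNorm_le_card_fintype (x := col v j)
      obtain ⟨m, hm⟩ : ∃ m, oneCoef v (fstCol m) ≠ 0 ∨ omegaCoef v (fstCol m) ≠ 0 := by
        by_contra! H
        exact hz H
      obtain ⟨m', hne', hm'⟩ :
          ∃ m', m' ≠ m ∧ (oneCoef v (fstCol m') ≠ 0 ∨ omegaCoef v (fstCol m') ≠ 0) := by
        by_contra! H
        rw [Finset.sum_eq_single m (fun i _ hi => (H i hi).1) (by simp)] at hx
        rw [Finset.sum_eq_single m (fun i _ hi => (H i hi).2) (by simp)] at hy
        simp_all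
      have e := hfour m hm
      have e' := hfour m' hm'
      rw [hammingNorm_eq_sum_col, sum_eq_sum_blocks, ← Finset.add_sum_erase _ _ (Finset.mem_univ m),
        ← Finset.add_sum_erase _ _ (Finset.mem_erase.2 ⟨hne', Finset.mem_univ m'⟩), e, e']
      have hcard : ((Finset.univ.erase m).erase m').card = 3 := by
        rw [Finset.card_erase_of_mem (by simp [hne']), Finset.card_erase_of_mem (by simp)]
        rfl
      have := Finset.sum_le_card_nsmul ((Finset.univ.erase m).erase m')
        (fun m => hammingNorm (col v (fstCol m)) + hammingNorm (col v (sndCol m))) 8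
        fun i _ => add_le_add (hle _) (hle _)
      rw [hcard, smul_eq_mul] at this
      omega

theorem exists_mem_checkCode_hammingDist_le (v : Fin 40 → ZMod 2) :
    ∃ c ∈ checkCode, hammingDist v c ≤ 8 := by
  obtain ⟨c, hc, hd⟩ := exists_dual_hammingDist_le checkCode [8, 12, 16, 20, 24, 28, 32, 40]
    (by simp) (fun _ => hammingNorm_mem_of_mem_checkCode) v
  exact ⟨c, mem_checkCode_of_forall_dotProduct c hc, hd⟩

/-- A vector at distance at least 8 from `checkCode`. -/
def deepHole : Fin 40 → ZMod 2 := ofCols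
  ![![1, 0, 0, 0], ![1, 0, 0, 0], ![0, 1, 0, 0], ![1, 0, 0, 0], 0, 0, ![0, 0, 1, 1], 0,
    ![0, 1, 0, 1], 0]

theorem le_block_weight : ∀ (a b : Fin 4 → ZMod 2), ∑ k, a k = ∑ k, b k →
    (if ∑ k, a k = 0 ∧ a 1 + a 3 + (b 1 + b 3) = 0 ∧ a 2 + a 3 + (b 2 + b 3) = 0 then 0 else 2) ≤
      hammingNorm a + hammingNorm b := by
  decide +kernel

theorem le_hammingDist_deepHole {c : Fin 40 → ZMod 2} (hc : c ∈ checkCode) :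
    8 ≤ hammingDist deepHole c := by
  obtain ⟨h1, h2, h3, -⟩ := mem_checkCode.1 hc
  have e2 : ∀ m, oneCoef (deepHole - c) (fstCol m) + oneCoef (deepHole - c) (sndCol m) =
      oneCoef deepHole (fstCol m) + oneCoef deepHole (sndCol m) -
        (oneCoef c 0 + oneCoef c 1) := by
    intro m; rw [← h2 m, oneCoef_sub, oneCoef_sub]; ring
  have e3 : ∀ m, omegaCoef (deepHole - c) (fstCol m) + omegaCoef (deepHole - c) (sndCol m) =
      omegaCoef deepHole (fstCol m) + omegaCoef deepHole (sndCol m) -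
        (omegaCoef c 0 + omegaCoef c 1) := by
    intro m; rw [← h3 m, omegaCoef_sub, omegaCoef_sub]; ring
  have hpar : ∀ m, colPar deepHole (fstCol m) = colPar deepHole (sndCol m) := by decide +kernel
  have hb : ∀ m, (if colPar deepHole (fstCol m) - colPar c 0 = 0 ∧
      oneCoef deepHole (fstCol m) + oneCoef deepHole (sndCol m) -
        (oneCoef c 0 + oneCoef c 1) = 0 ∧
      omegaCoef deepHole (fstCol m) + omegaCoef deepHole (sndCol m) -
        (omegaCoef c 0 + omegaCoef c 1) = 0 then 0 else 2) ≤
      hammingNorm (col (deepHole - c) (fstCol m)) +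
        hammingNorm (col (deepHole - c) (sndCol m)) := by
    intro m
    rw [← e2, ← e3, ← h1 (fstCol m), ← colPar_sub]
    refine le_block_weight (col (deepHole - c) (fstCol m)) (col (deepHole - c) (sndCol m)) ?_
    change colPar (deepHole - c) (fstCol m) = colPar (deepHole - c) (sndCol m)
    rw [colPar_sub, colPar_sub, h1, h1 (sndCol m), hpar]
  rw [hammingDist_comm, hammingDist_eq_hammingNorm, neg_add_eq_sub, hammingNorm_eq_sum_col, sum_eq_sum_blocks]
  refine le_trans ?_ (Finset.sum_le_sum fun m _ => hb m)
  generalize colPar c 0 = p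
  generalize oneCoef c 0 + oneCoef c 1 = x
  generalize omegaCoef c 0 + omegaCoef c 1 = y
  revert p x y
  decide +kernel

theorem column_constant_iff : ∀ a : Fin 4 → ZMod 2,
    (∀ k k', a k = a k') ↔ ∑ k, a k = 0 ∧ a 1 + a 3 = 0 ∧ a 2 + a 3 = 0 := by
  decide +kernel

theorem mem_d4ten0_iff_s15 {v : Fin 40 → ZMod 2} : v ∈ d4ten0 ↔
    (∀ j, colPar v j = 0 ∧ oneCoef v j = 0 ∧ omegaCoef v j = 0) ∧ topPar v = 0 := by
  have hconst : v ∈ d4ten ↔ ∀ j, colPar v j = 0 ∧ oneCoef v j = 0 ∧ omegaCoef v j = 0 :=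
    forall_congr' fun j => column_constant_iff (col v j)
  refine (and_congr_left' hconst).trans (and_congr_right fun h => ?_)
  have hinj : ∀ t, bitToEight t = 0 ↔ t = 0 := by decide
  rw [← hinj, ← ZMod.natCast_eq_zero_iff, hammingNorm_eq_sum_col, Nat.cast_sum,
    Finset.sum_congr rfl fun j _ => weight_mod_eight (col v j) (h j).1 (h j).2.1 (h j).2.2,
    ← map_sum]
  rfl

section FieldWithFourElements

variable {F : Type} [Field F]

theorem mem_E10_iff_s15 [CharP F 2] {ω : F} (hω : ω ^ 2 = ω + 1) {c : Fin 10 → F} :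
    c ∈ E10 ω ↔ (∀ m, c (fstCol m) + c (sndCol m) = c 0 + c 1) ∧
      ∑ m, c (fstCol m) = ω * (c 0 + c 1) := by
  have h2 : (2 : F) = 0 := CharTwo.two_eq_zero
  constructor
  · intro hc
    induction hc using Submodule.span_induction with
    | mem x hx =>
      simp only [Set.mem_insert_iff, Set.mem_singleton_iff] at hx
      rcases hx with rfl | rfl | rfl | rfl | rfl <;>
      · refine ⟨fun m => ?_, ?_⟩
        · fin_cases m <;> simp [fstCol, sndCol] <;> grind
        · simp [fstCol, Fin.sum_univ_five]; grind
    | zero => simp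
    | add x y _ _ hx hy =>
      simp only [Pi.add_apply, Finset.sum_add_distrib]
      exact ⟨fun m => by linear_combination hx.1 m + hy.1 m, by linear_combination hx.2 + hy.2⟩
    | smul a x _ hx =>
      simp only [Pi.smul_apply, smul_eq_mul, ← Finset.mul_sum]
      exact ⟨fun m => by linear_combination a * hx.1 m, by linear_combination a * hx.2⟩
  · rintro ⟨h, hs⟩
    have h1 := h 1
    have h3 := h 2
    have h4 := h 3
    have h5 := h 4
    simp only [fstCol, sndCol, Fin.sum_univ_five] at h1 h3 h4 h5 hs
    have hc : c = (c 0 + (c 0 + c 1)) • ![1,1,1,1,0,0,0,0,0,0] +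
        (c 0 + c 2) • ![0,0,1,1,1,1,0,0,0,0] +
        (c 0 + c 2 + c 4 + (c 0 + c 1)) • ![0,0,0,0,1,1,1,1,0,0] +
        (c 0 + c 2 + c 4 + c 6) • ![0,0,0,0,0,0,1,1,1,1] +
        (c 0 + c 1) • ![1,0,1,0,1,0,1,0,ω,ω^2] := by
      ext j
      fin_cases j <;> simp at * <;> grind
    rw [hc]
    refine add_mem (add_mem (add_mem (add_mem ?_ ?_) ?_) ?_) ?_ <;>
    exact Submodule.smul_mem _ _ (Submodule.subset_span (by simp))

/-- The element `x + y * ω` of GF(4) with coefficients `x` and `y` in the prime field. -/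
def ofBits [CharP F 2] (ω : F) (x y : ZMod 2) : F :=
  ZMod.castHom dvd_rfl F x + ZMod.castHom dvd_rfl F y * ω

variable [CharP F 2] {ω : F}

theorem ofBits_add (x y x' y' : ZMod 2) :
    ofBits ω (x + x') (y + y') = ofBits ω x y + ofBits ω x' y' := by
  simp only [ofBits, map_add]
  ring

theorem sum_ofBits {ι : Type*} (s : Finset ι) (x y : ι → ZMod 2) :
    ∑ i ∈ s, ofBits ω (x i) (y i) = ofBits ω (∑ i ∈ s, x i) (∑ i ∈ s, y i) := by
  simp only [ofBits, map_sum, Finset.sum_add_distrib, Finset.sum_mul]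

theorem mul_ofBits (hω : ω ^ 2 = ω + 1) (x y : ZMod 2) :
    ω * ofBits ω x y = ofBits ω y (x + y) := by
  simp only [ofBits, map_add]
  linear_combination ZMod.castHom dvd_rfl F y * hω

theorem phi_ofBits [DecidableEq F] (hω : ω ^ 2 = ω + 1) (x y : ZMod 2) :
    phi ω (ofBits ω x y) = ![0, y, x, x + y] := by
  have h2 : (2 : F) = 0 := CharTwo.two_eq_zero
  have h0 : ω ≠ 0 := by rintro rfl; simp at hω
  have h1 : ω ≠ 1 := by
    rintro rfl
    exact one_ne_zero (by linear_combination -hω : (1 : F) = 0)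
  have h3 : 1 + ω ≠ 0 := fun h => h1 (by linear_combination h - h2)
  have hbit : ∀ x : ZMod 2, x = 0 ∨ x = 1 := by decide
  have h11 : (1 : ZMod 2) + 1 = 0 := rfl
  rcases hbit x with rfl | rfl <;> rcases hbit y with rfl | rfl <;>
    simp [phi, ofBits, h0, h1, h3, h11, -ZMod.castHom_apply]

theorem ofBits_inj (hω : ω ^ 2 = ω + 1) {x y x' y' : ZMod 2} :
    ofBits ω x y = ofBits ω x' y' ↔ x = x' ∧ y = y' := by
  classical
  refine ⟨fun h => ?_, by rintro ⟨rfl, rfl⟩; rfl⟩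
  have h' := congrArg (phi ω) h
  rw [phi_ofBits hω, phi_ofBits hω] at h'
  exact ⟨congrFun h' 2, congrFun h' 1⟩

theorem exists_eq_ofBits [Fintype F] (hF : Fintype.card F = 4) (hω : ω ^ 2 = ω + 1) (z : F) :
    ∃ x y, z = ofBits ω x y := by
  have hbij : Function.Bijective fun p : ZMod 2 × ZMod 2 => ofBits ω p.1 p.2 := by
    rw [Fintype.bijective_iff_injective_and_card]
    refine ⟨fun p q h => Prod.ext_iff.2 ((ofBits_inj hω).1 h), ?_⟩
    rw [hF]
    rfl
  obtain ⟨p, hp⟩ := hbij.2 z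
  exact ⟨p.1, p.2, hp.symm⟩

theorem ofBits_mem_E10_iff (hω : ω ^ 2 = ω + 1) (x y : Fin 10 → ZMod 2) :
    (fun j => ofBits ω (x j) (y j)) ∈ E10 ω ↔
      (∀ m, x (fstCol m) + x (sndCol m) = x 0 + x 1) ∧
      (∀ m, y (fstCol m) + y (sndCol m) = y 0 + y 1) ∧
      ∑ m, x (fstCol m) = y 0 + y 1 ∧ ∑ m, y (fstCol m) = x 0 + x 1 + (y 0 + y 1) := by
  rw [mem_E10_iff_s15 hω]
  simp only [sum_ofBits, ← ofBits_add, mul_ofBits hω, ofBits_inj hω, forall_and]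
  exact and_assoc

theorem mem_checkCode_of_mem_hatSet [DecidableEq F] [Fintype F] (hF : Fintype.card F = 4)
    (hω : ω ^ 2 = ω + 1) {v : Fin 40 → ZMod 2} (hv : v ∈ hatSet ω (E10 ω : Set (Fin 10 → F))) :
    v ∈ checkCode := by
  obtain ⟨c, hc, hv⟩ := hv
  choose x y hxy using fun j => exists_eq_ofBits hF hω (c j)
  have hcol : ∀ j k, v (idx j k) = ![0, y j, x j, x j + y j] k := fun j k => by
    rw [hv, hxy, phi_ofBits hω]
  have hpar : ∀ j, colPar v j = 0 := fun j => by
    simp only [colPar, hcol, Fin.sum_univ_four]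
    generalize x j = s
    generalize y j = t
    revert s t
    decide
  have hone : ∀ j, oneCoef v j = x j := fun j => by
    simp only [oneCoef, hcol]
    generalize x j = s
    generalize y j = t
    revert s t
    decide
  have homega : ∀ j, omegaCoef v j = y j := fun j => by
    simp only [omegaCoef, hcol]
    generalize x j = s
    generalize y j = t
    revert s t
    decide
  obtain ⟨h1, h2, h3, h4⟩ := (ofBits_mem_E10_iff hω x y).1 (by rwa [← funext hxy])
  rw [mem_checkCode]
  simp only [hpar, hone, homega]
  exact ⟨fun _ => trivial, h1, h2, h3, h4, by simp [topPar, hcol]⟩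

theorem eBvec_mem_checkCode : eBvec ∈ checkCode := by
  decide +kernel

/-- The code `ρ_B(E₁₀)` is cut out by the parity checks defining `checkCode`. -/
theorem mem_rhoB_E10_iff [DecidableEq F] [Fintype F] (hF : Fintype.card F = 4)
    (hω : ω ^ 2 = ω + 1) {v : Fin 40 → ZMod 2} :
    v ∈ rhoB ω (E10 ω : Set (Fin 10 → F)) ↔ v ∈ checkCode := by
  constructor
  · rintro ⟨a, ha, b, hb, e, he, rfl⟩
    refine add_mem (add_mem (mem_checkCode_of_mem_hatSet hF hω ha) ?_) ?_
    · obtain ⟨h, ht⟩ := mem_d4ten0_iff_s15.1 hb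
      rw [mem_checkCode]
      simp [h, ht]
    · rcases he with rfl | rfl
      exacts [zero_mem _, eBvec_mem_checkCode]
  · intro hv
    obtain ⟨e, he, hpar⟩ : ∃ e ∈ ({0, eBvec} : Set (Fin 40 → ZMod 2)), colPar (v - e) 0 = 0 := by
      have hbit : ∀ x : ZMod 2, x = 0 ∨ x = 1 := by decide
      rcases hbit (colPar v 0) with h | h
      · exact ⟨0, by simp, by simpa using h⟩
      · refine ⟨eBvec, by simp, ?_⟩
        rw [colPar_sub, h]
        decide
    have hw : v - e ∈ checkCode := by
      refine sub_mem hv ?_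
      rcases he with rfl | rfl
      exacts [zero_mem _, eBvec_mem_checkCode]
    generalize hwe : v - e = w at hpar hw
    obtain ⟨h1, h2, h3, h4, h5, h6⟩ := mem_checkCode.1 hw
    have ha : ofCols (fun j => ![0, omegaCoef w j, oneCoef w j, oneCoef w j + omegaCoef w j]) ∈
        hatSet ω (E10 ω : Set (Fin 10 → F)) :=
      ⟨_, (ofBits_mem_E10_iff hω (oneCoef w) (omegaCoef w)).2 ⟨h2, h3, h4, h5⟩, fun j k => by
        rw [ofCols_idx, phi_ofBits hω]⟩
    refine ⟨_, ha, w - ofCols _, mem_d4ten0_iff_s15.2 ⟨fun j => ?_, ?_⟩, e, he,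
      by rw [add_sub_cancel, ← hwe, sub_add_cancel]⟩
    · rw [colPar_sub, oneCoef_sub, omegaCoef_sub, h1, hpar]
      simp only [colPar, oneCoef, omegaCoef, ofCols_idx, Fin.sum_univ_four]
      generalize w (idx j 1) = x
      generalize w (idx j 2) = y
      generalize w (idx j 3) = z
      revert x y z
      decide
    · rw [topPar_sub, h6, hpar]
      simp [topPar, ofCols_idx]

end FieldWithFourElements

/-- The covering radius of C₄₀,₁ᴰᴱ = ρ_B(E₁₀) is 8. -/
theorem stmt_15 (F : Type) [Field F] [Fintype F] [DecidableEq F]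
    (hF : Fintype.card F = 4) (ω : F) (hω : ω ^ 2 = ω + 1) :
    (∀ v : Fin 40 → ZMod 2,
      ∃ c ∈ rhoB ω (E10 ω : Set (Fin 10 → F)), hammingDist v c ≤ 8) ∧
    (∃ v : Fin 40 → ZMod 2,
      ∀ c ∈ rhoB ω (E10 ω : Set (Fin 10 → F)), 8 ≤ hammingDist v c) := by
  have h2 : (2 : F) = 0 := by
    have h4 : ((4 : ℕ) : F) = 0 := hF ▸ Nat.cast_card_eq_zero F
    exact pow_eq_zero_iff two_ne_zero |>.1 (by push_cast at h4; linear_combination h4)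
  have : CharP F 2 := CharTwo.of_one_ne_zero_of_two_eq_zero one_ne_zero h2
  simp only [mem_rhoB_E10_iff hF hω]
  exact ⟨exists_mem_checkCode_hammingDist_le, deepHole, fun c => le_hammingDist_deepHole⟩
end
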